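/- Let f : ℝ^d → ℝ be L-smooth, let y ∈ ℝ^d, and let g be a random vector in ℝ^d with E[‖g‖²] ≤ ρ‖∇f(y)‖² + σ² for some ρ, σ² ≥ 0. Set x⁺ = y − η g with 0 < η ≤ 1/(2ρL). Then E[f(x⁺)] − f(y) ≤ −(η/4)‖∇f(y)‖² + (η/2)‖E[g] − ∇f(y)‖² + (L η² σ²)/2; consequently ‖∇f(y)‖² ≤ (4/η)(f(y) − E[f(x⁺)]) + 2‖E[g] − ∇f(y)‖² + 2 L η σ². -/

import Mathlib

open MeasureTheory
open scoped RealInnerProductSpace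

/-- One-step descent bound for a stochastic gradient step with biased oracle:
if `f` is `L`-smooth, `E[‖g‖²] ≤ ρ‖∇f(y)‖² + σ²`, and `x⁺ = y - η g` with
`0 < η ≤ 1/(2ρL)`, then `E[f(x⁺)] - f(y) ≤ -(η/4)‖∇f(y)‖² + (η/2)‖E[g] - ∇f(y)‖²
+ Lη²σ²/2`, and consequently
`‖∇f(y)‖² ≤ (4/η)(f(y) - E[f(x⁺)]) + 2‖E[g] - ∇f(y)‖² + 2Lησ²`. -/
theorem stmt6 (d : ℕ) (f : EuclideanSpace ℝ (Fin d) → ℝ) (L ρ σ2 η : ℝ)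
    (hL : 0 < L) (hρ : 0 ≤ ρ) (hσ : 0 ≤ σ2)
    (hdiff : Differentiable ℝ f)
    (hsmooth : ∀ u v : EuclideanSpace ℝ (Fin d),
      f v ≤ f u + ⟪gradient f u, v - u⟫ + L / 2 * ‖v - u‖ ^ 2)
    (y : EuclideanSpace ℝ (Fin d))
    (Ω : Type) [MeasureSpace Ω] (hP : IsProbabilityMeasure (volume : Measure Ω))
    (g : Ω → EuclideanSpace ℝ (Fin d))
    (hgInt : Integrable g)
    (hg2 : Integrable (fun ω => ‖g ω‖ ^ 2))
    (hfInt : Integrable (fun ω => f (y - η • g ω)))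
    (hmom : (∫ ω, ‖g ω‖ ^ 2) ≤ ρ * ‖gradient f y‖ ^ 2 + σ2)
    (hη0 : 0 < η) (hη : η ≤ 1 / (2 * ρ * L)) :
    (∫ ω, f (y - η • g ω)) - f y ≤
        -(η / 4) * ‖gradient f y‖ ^ 2
          + η / 2 * ‖(∫ ω, g ω) - gradient f y‖ ^ 2 + L * η ^ 2 * σ2 / 2 ∧
    ‖gradient f y‖ ^ 2 ≤
        4 / η * (f y - ∫ ω, f (y - η • g ω))
          + 2 * ‖(∫ ω, g ω) - gradient f y‖ ^ 2 + 2 * L * η * σ2 := by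
  set G := gradient f y
  set m := ∫ ω, g ω
  have descent : (∫ ω, f (y - η • g ω)) ≤
      f y - η * ⟪G, m⟫ + L / 2 * η ^ 2 * ∫ ω, ‖g ω‖ ^ 2 := by
    have hinner : Integrable (fun ω => ⟪G, g ω⟫) := hgInt.const_inner G
    have hlin : Integrable (fun ω => f y - η * ⟪G, g ω⟫) :=
      (integrable_const _).sub (hinner.const_mul η)
    have hquad : Integrable (fun ω => L / 2 * η ^ 2 * ‖g ω‖ ^ 2) := hg2.const_mul _
    calc (∫ ω, f (y - η • g ω))
        ≤ ∫ ω, (f y - η * ⟪G, g ω⟫) + L / 2 * η ^ 2 * ‖g ω‖ ^ 2 := by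
          refine integral_mono hfInt (hlin.add hquad) fun ω => ?_
          refine (hsmooth y (y - η • g ω)).trans_eq ?_
          rw [sub_sub_cancel_left, inner_neg_right, real_inner_smul_right, norm_neg,
            norm_smul, mul_pow, Real.norm_eq_abs, sq_abs]
          ring
      _ = _ := by
          rw [integral_add hlin hquad, integral_sub (integrable_const _) (hinner.const_mul η),
            integral_const_mul, integral_const_mul, integral_inner hgInt]
          simp [m]
  have hρ_pos : 0 < ρ := by
    refine hρ.lt_of_ne fun h => ?_
    rw [← h] at hη
    norm_num at hη
    linarith
  have step : η * (2 * ρ * L) ≤ 1 := (le_div_iff₀ (by positivity)).1 hη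
  have second_moment : L / 2 * η ^ 2 * ∫ ω, ‖g ω‖ ^ 2 ≤
      η / 4 * ‖G‖ ^ 2 + L * η ^ 2 * σ2 / 2 := by
    have h₁ := mul_le_mul_of_nonneg_left hmom (by positivity : 0 ≤ L / 2 * η ^ 2)
    have h₂ := mul_le_mul_of_nonneg_left step (by positivity : 0 ≤ η / 4 * ‖G‖ ^ 2)
    linarith
  have polarization : -(η * ⟪G, m⟫) ≤ η / 2 * ‖m - G‖ ^ 2 - η / 2 * ‖G‖ ^ 2 := by
    rw [norm_sub_sq_real, real_inner_comm]
    have := mul_nonneg hη0.le (sq_nonneg ‖m‖)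
    linarith
  have bound : (∫ ω, f (y - η • g ω)) - f y ≤
      -(η / 4) * ‖G‖ ^ 2 + η / 2 * ‖m - G‖ ^ 2 + L * η ^ 2 * σ2 / 2 := by
    linarith
  refine ⟨bound, ?_⟩
  have scaled := mul_le_mul_of_nonneg_left bound (by positivity : 0 ≤ 4 / η)
  have expand : 4 / η * (-(η / 4) * ‖G‖ ^ 2 + η / 2 * ‖m - G‖ ^ 2 + L * η ^ 2 * σ2 / 2) =
      -‖G‖ ^ 2 + 2 * ‖m - G‖ ^ 2 + 2 * L * η * σ2 := by
    field_simp
    ring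
  linarith
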